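/- arXiv:1803.05559 — 2 statements merged into one kernel-verified Lean document; each statement's English description precedes it below -/
import Mathlib

section
/- The quantity Φ(2m+1) = (1/2)·∑_{s=1}^{m} φ(2s+1) is asymptotically equivalent to (2m+1)²/π² as m → ∞; that is, Φ(2m+1)·π²/(2m+1)² tends to 1. -/
open Filter

lemma phi_eq (n : ℕ) (hn : 0 < n) : (Nat.totient n : ℝ) = ∑ p ∈ n.divisorsAntidiagonal, (ArithmeticFunction.moebius p.1 : ℝ) * p.2 := by
  have := (ArithmeticFunction.sum_eq_iff_sum_mul_moebius_eq (f := fun n => (Nat.totient n : ℝ)) (g := fun n => (n:ℝ))).1 (fun n _ => by exact_mod_cast Nat.sum_totient n) n hn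
  exact this.symm

lemma comb (f : ℕ × ℕ → ℝ) (m : ℕ) : ∑ s ∈ Finset.range (m+1), ∑ p ∈ (2*s+1).divisorsAntidiagonal, f p
   = ∑ e ∈ Finset.range (m+1), ∑ j ∈ Finset.range ((m+e+1)/(2*e+1)), f (2*e+1, 2*j+1) := by
  rw [Finset.sum_sigma', Finset.sum_sigma']
  symm
  refine Finset.sum_bij (fun x _ => (⟨2*x.1*x.2+x.1+x.2, (2*x.1+1, 2*x.2+1)⟩ : Σ _ : ℕ, ℕ × ℕ)) ?_ ?_ ?_ ?_
  · rintro ⟨e, j⟩ h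
    simp only [Finset.mem_sigma, Finset.mem_range, Nat.mem_divisorsAntidiagonal] at h ⊢
    obtain ⟨h1, h2⟩ := h
    rw [← Nat.succ_le_iff, Nat.le_div_iff_mul_le (by omega)] at h2
    refine ⟨by nlinarith, by ring, by omega⟩
  · rintro ⟨e, j⟩ h ⟨e', j'⟩ h' hh
    simp only [Sigma.mk.injEq, heq_eq_eq, Prod.mk.injEq] at hh ⊢
    omega
  · rintro ⟨s, a, b⟩ h
    simp only [Finset.mem_sigma, Finset.mem_range, Nat.mem_divisorsAntidiagonal] at h
    obtain ⟨h1, h2, -⟩ := h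
    have ho : Odd (a * b) := h2 ▸ ⟨s, rfl⟩
    obtain ⟨⟨e, rfl⟩, ⟨j, rfl⟩⟩ := Nat.odd_mul.1 ho
    have h3 : s = 2*e*j+e+j := by nlinarith
    refine ⟨⟨e, j⟩, ?_, ?_⟩
    · simp only [Finset.mem_sigma, Finset.mem_range]
      rw [← Nat.succ_le_iff, ← Nat.succ_le_iff, Nat.le_div_iff_mul_le (by omega)]
      constructor <;> nlinarith [Nat.zero_le (e*j)]
    · simp [h3]
  · rintro ⟨e, j⟩ h
    rfl

lemma sumodd (c : ℕ) : ∑ j ∈ Finset.range c, ((2*j+1 : ℕ) : ℝ) = (c:ℝ)^2 := by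
  induction c with
  | zero => simp
  | succ n ih => rw [Finset.sum_range_succ, ih]; push_cast; ring

lemma key (m : ℕ) : ∑ s ∈ Finset.range (m+1), (Nat.totient (2*s+1) : ℝ) =
    ∑' e : ℕ, (ArithmeticFunction.moebius (2*e+1) : ℝ) * (((m+e+1)/(2*e+1) : ℕ) : ℝ)^2 := by
  rw [tsum_eq_sum (s := Finset.range (m+1))]
  · rw [Finset.sum_congr rfl (fun s _ => phi_eq (2*s+1) (by omega)), comb]
    refine Finset.sum_congr rfl fun e _ => ?_
    rw [← sumodd, Finset.mul_sum]
  · intro e he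
    rw [Nat.div_eq_of_lt (by simp at he; omega)]
    simp

lemma hsum : HasSum (fun n : ℕ => (ArithmeticFunction.moebius n : ℝ) / (n:ℝ)^2) (6 / Real.pi^2) := by
  have h1 : (1:ℝ) < (2:ℂ).re := by norm_num
  have hs := ArithmeticFunction.LSeriesSummable_moebius_iff.2 h1
  have h2 := ArithmeticFunction.LSeries_zeta_mul_Lseries_moebius h1
  rw [ArithmeticFunction.LSeries_zeta_eq_riemannZeta h1, riemannZeta_two] at h2
  have h3 := hs.LSeriesHasSum
  unfold LSeriesHasSum at h3
  rw [← Complex.hasSum_ofReal]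
  convert h3 using 1
  · ext n
    rcases eq_or_ne n 0 with rfl | hn
    · simp
    · rw [LSeries.term_of_ne_zero hn]
      push_cast
      norm_cast
  · have : (Real.pi : ℂ) ≠ 0 := by exact_mod_cast Real.pi_ne_zero
    push_cast
    field_simp at h2 ⊢
    linear_combination -h2

lemma hodd_aux (f : ℕ → ℝ) (S : ℝ) (hf : HasSum f S) (h4 : ∀ k, f (2*(2*k)) = 0)
    (h2 : ∀ k, f (2*(2*k+1)) = -(1/4) * f (2*k+1)) : ∑' e : ℕ, f (2*e+1) = 4/3 * S := by
  have hs := hf.summable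
  have i1 : Function.Injective (fun k : ℕ => 2*k) := fun a b h => by simpa using h
  have i2 : Function.Injective (fun k : ℕ => 2*k+1) := fun a b h => by simpa using h
  have hE : Summable (fun k => f (2*k)) := hs.comp_injective i1
  have hO : Summable (fun k => f (2*k+1)) := hs.comp_injective i2
  have hEE : Summable (fun k => f (2*(2*k))) := hE.comp_injective i1
  have hEO : Summable (fun k => f (2*(2*k+1))) := hE.comp_injective i2
  have t1 := tsum_even_add_odd hE hO
  have t2 := tsum_even_add_odd (f := fun k => f (2*k)) hEE hEO
  rw [hf.tsum_eq] at t1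
  simp only [h4, h2, tsum_zero, tsum_mul_left] at t2
  linarith

lemma hodd : ∑' e : ℕ, (ArithmeticFunction.moebius (2*e+1) : ℝ) / ((2*e+1 : ℕ):ℝ)^2 = 8 / Real.pi^2 := by
  rw [show (8:ℝ) / Real.pi^2 = 4/3 * (6 / Real.pi^2) by ring]
  refine hodd_aux (fun n : ℕ => (ArithmeticFunction.moebius n : ℝ) / (n:ℝ)^2) _ hsum ?_ ?_
  · intro k
    beta_reduce
    rw [ArithmeticFunction.moebius_eq_zero_of_not_squarefree]
    · simp
    · intro h
      have h3 := h 2 ⟨k, by ring⟩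
      rw [Nat.isUnit_iff] at h3
      omega
  · intro k
    beta_reduce
    rw [ArithmeticFunction.isMultiplicative_moebius.map_mul_of_coprime (by simp), ArithmeticFunction.moebius_apply_prime Nat.prime_two]
    push_cast
    field_simp
    norm_num

lemma lim (e : ℕ) : Tendsto (fun m : ℕ => (((m+e+1)/(2*e+1) : ℕ) : ℝ) / (2*m+1)) atTop (nhds (1 / (2 * (2*e+1)))) := by
  have hz : Tendsto (fun m : ℕ => (1:ℝ) / (2*m+1)) atTop (nhds 0) := by
    refine Tendsto.div_atTop tendsto_const_nhds ?_
    exact tendsto_atTop_add_const_right _ _ (tendsto_natCast_atTop_atTop.const_mul_atTop (by norm_num))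
  have hd : (0:ℝ) < 2*e+1 := by positivity
  have L : Tendsto (fun m : ℕ => (1:ℝ) / (2 * (2*e+1)) - 1 * (1 / (2*m+1))) atTop (nhds (1 / (2 * (2*e+1)))) := by
    simpa using (hz.const_mul 1).const_sub ((1:ℝ) / (2 * (2*e+1)))
  have U : Tendsto (fun m : ℕ => (1:ℝ) / (2 * (2*e+1)) + 1 * (1 / (2*m+1))) atTop (nhds (1 / (2 * (2*e+1)))) := by
    simpa using (hz.const_mul 1).const_add ((1:ℝ) / (2 * (2*e+1)))
  refine tendsto_of_tendsto_of_tendsto_of_le_of_le L U ?_ ?_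
  all_goals
    intro m
    beta_reduce
    have hm : (0:ℝ) < 2*m+1 := by positivity
    have hc := Nat.div_add_mod (m+e+1) (2*e+1)
    have hr := Nat.mod_lt (m+e+1) (show 0 < 2*e+1 by omega)
    generalize (m+e+1)/(2*e+1) = c at *
    generalize (m+e+1)%(2*e+1) = r at *
    have hc' : (2*e+1:ℝ)*c + r = m+e+1 := by exact_mod_cast hc
    have hr' : (r:ℝ) + 1 ≤ 2*e+1 := by exact_mod_cast hr
    have hr0 : (0:ℝ) ≤ r := by positivity
    have he0 : (0:ℝ) ≤ e := by positivity
    have hm0 : (0:ℝ) ≤ m := by positivity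
    field_simp
    nlinarith

lemma bnd (e m : ℕ) : (((m+e+1)/(2*e+1) : ℕ) : ℝ) / (2*m+1) ≤ 1 / ((2*e+1 : ℕ):ℝ) := by
  have hm : (0:ℝ) < 2*m+1 := by positivity
  rcases Nat.lt_or_ge m e with h | h
  · rw [Nat.div_eq_of_lt (by omega)]; simp; positivity
  · rw [div_le_div_iff₀ hm (by positivity)]
    have := Nat.div_mul_le_self (m+e+1) (2*e+1)
    have : (m+e+1)/(2*e+1) * (2*e+1) ≤ 1 * (2*m+1) := by omega
    exact_mod_cast this

lemma main : Tendsto (fun m : ℕ => (∑ s ∈ Finset.range (m+1), (Nat.totient (2*s+1) : ℝ)) / (2*m+1)^2) atTop (nhds (2 / Real.pi^2)) := by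
  have e1 : (2 / Real.pi^2 : ℝ) = ∑' e : ℕ, (ArithmeticFunction.moebius (2*e+1) : ℝ) * (1 / (2 * (2*e+1)))^2 := by
    rw [show (2 / Real.pi^2 : ℝ) = 1/4 * (8 / Real.pi^2) by ring, ← hodd, ← tsum_mul_left]
    congr 1; ext e
    push_cast
    field_simp
    ring
  rw [e1]
  have e2 : (fun m : ℕ => (∑ s ∈ Finset.range (m+1), (Nat.totient (2*s+1) : ℝ)) / (2*m+1)^2) =
     fun m : ℕ => ∑' e : ℕ, (ArithmeticFunction.moebius (2*e+1) : ℝ) * ((((m+e+1)/(2*e+1) : ℕ) : ℝ) / (2*m+1))^2 := by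
    ext m
    rw [key, ← tsum_div_const]
    congr 1; ext e
    rw [div_pow, mul_div_assoc]
  rw [e2]
  refine tendsto_tsum_of_dominated_convergence (bound := fun e : ℕ => (1 / ((2*e+1 : ℕ):ℝ))^2) ?_ ?_ ?_
  · have i2 : Function.Injective (fun k : ℕ => 2*k+1) := fun a b h => by simpa using h
    have := hasSum_zeta_two.summable.comp_injective i2
    simpa [Function.comp_def] using this
  · intro e
    exact ((lim e).pow 2).const_mul _
  · refine Eventually.of_forall fun m e => ?_
    rw [norm_mul, norm_pow, Real.norm_eq_abs, Real.norm_eq_abs]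
    have a1 : |(ArithmeticFunction.moebius (2*e+1) : ℝ)| ≤ 1 := by
      exact_mod_cast ArithmeticFunction.abs_moebius_le_one
    have a2 : 0 ≤ (((m+e+1)/(2*e+1) : ℕ) : ℝ) / (2*m+1) := by positivity
    rw [abs_of_nonneg a2]
    calc _ ≤ 1 * ((((m+e+1)/(2*e+1) : ℕ) : ℝ) / (2*m+1))^2 := by gcongr
      _ ≤ _ := by rw [one_mul]; exact pow_le_pow_left₀ a2 (bnd e m) 2

/-- Corollary D(ii): Φ(2m+1) = (1/2)·∑_{s=1}^m φ(2s+1) ∼ (2m+1)²/π² as m → ∞. -/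
theorem stmt_5 :
    Tendsto (fun m : ℕ =>
      ((∑ s ∈ Finset.Icc 1 m, Nat.totient (2 * s + 1) : ℝ) / 2) * Real.pi ^ 2 /
        (2 * m + 1) ^ 2)
      atTop (nhds 1) := by
  have hz : Tendsto (fun m : ℕ => (1:ℝ) / (2*m+1)^2) atTop (nhds 0) := by
    refine Tendsto.div_atTop tendsto_const_nhds ?_
    refine (tendsto_pow_atTop (by norm_num)).comp ?_
    exact tendsto_atTop_add_const_right _ _ (tendsto_natCast_atTop_atTop.const_mul_atTop (by norm_num))
  have h := (main.sub hz).mul_const (Real.pi^2 / 2)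
  have hp := Real.pi_ne_zero
  have e1 : (2 / Real.pi^2 - 0) * (Real.pi^2 / 2) = 1 := by field_simp; ring
  rw [e1] at h
  refine h.congr fun m => ?_
  have : ∑ s ∈ Finset.range (m+1), (Nat.totient (2*s+1) : ℝ) = 1 + ∑ s ∈ Finset.Icc 1 m, (Nat.totient (2*s+1) : ℝ) := by
    rw [Finset.range_eq_Ico, Finset.sum_eq_sum_Ico_succ_bot (by omega)]
    congr 1
    simp
  rw [this]
  ring
end

section
/- Let Ψ(n) = ∑_{i ≤ n, i odd} φ(i), the sum of Euler's totient function over the odd positive integers up to n. Then Ψ(n) is asymptotically equivalent to 2n²/π² as n → ∞; that is, Ψ(n)·π²/(2n²) tends to 1. -/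
open Filter

/-- Möbius function restricted to the odd integers. -/
noncomputable def oddMu : ArithmeticFunction ℝ :=
  ⟨fun d => if Odd d then (ArithmeticFunction.moebius d : ℝ) else 0, by simp⟩

/-- Identity restricted to the odd integers. -/
noncomputable def oddId : ArithmeticFunction ℝ :=
  ⟨fun d => if Odd d then (d : ℝ) else 0, by simp⟩

lemma oddMu_apply (d : ℕ) :
    oddMu d = if Odd d then (ArithmeticFunction.moebius d : ℝ) else 0 := rfl

lemma oddId_apply (d : ℕ) : oddId d = if Odd d then (d : ℝ) else 0 := rfl

lemma abs_oddMu_le (d : ℕ) : |oddMu d| ≤ 1 := by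
  rw [oddMu_apply]
  split_ifs
  · have := @ArithmeticFunction.abs_moebius_le_one d
    exact_mod_cast this
  · simp

lemma oddMu_mul_oddId (n : ℕ) (hn : 0 < n) :
    (oddMu * oddId) n = if Odd n then (Nat.totient n : ℝ) else 0 := by
  have h := (ArithmeticFunction.sum_eq_iff_sum_mul_moebius_eq (R := ℝ)
    (f := fun i => (Nat.totient i : ℝ)) (g := fun i => (i : ℝ))).1 (by
      intro n _
      exact_mod_cast Nat.sum_totient n) n hn
  rw [ArithmeticFunction.mul_apply]
  split_ifs with ho
  · rw [← h]
    refine Finset.sum_congr rfl fun x hx => ?_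
    have hx := (Nat.mem_divisorsAntidiagonal.1 hx).1
    rw [← hx, Nat.odd_mul] at ho
    rw [oddMu_apply, oddId_apply, if_pos ho.1, if_pos ho.2]
  · refine Finset.sum_eq_zero fun x hx => ?_
    have hx := (Nat.mem_divisorsAntidiagonal.1 hx).1
    rw [← hx, Nat.odd_mul] at ho
    rw [oddMu_apply, oddId_apply]
    split_ifs <;> simp_all

lemma sum_oddId (m : ℕ) : ∑ k ∈ Finset.Ioc 0 m, oddId k = (((m + 1) / 2 : ℕ) : ℝ) ^ 2 := by
  induction m with
  | zero => simp
  | succ m ih =>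
    rw [Finset.sum_Ioc_succ_top (Nat.zero_le m), ih, oddId_apply]
    rcases Nat.even_or_odd' m with ⟨c, rfl | rfl⟩
    · have h1 : (2 * c + 1) / 2 = c := by omega
      have h2 : (2 * c + 1 + 1) / 2 = c + 1 := by omega
      rw [h1, h2, if_pos ⟨c, rfl⟩]; push_cast; ring
    · have h1 : (2 * c + 1 + 1) / 2 = c + 1 := by omega
      have h2 : (2 * c + 1 + 1 + 1) / 2 = c + 1 := by omega
      rw [h1, h2, if_neg (by rw [Nat.not_odd_iff_even]; exact ⟨c + 1, by ring⟩)]; simp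

lemma psi_eq (n : ℕ) :
    (∑ i ∈ (Finset.range (n + 1)).filter (fun i => Odd i), Nat.totient i : ℝ) =
      ∑ d ∈ Finset.Ioc 0 n, oddMu d * (((n / d + 1) / 2 : ℕ) : ℝ) ^ 2 := by
  have h := ArithmeticFunction.sum_Ioc_mul_eq_sum_sum oddMu oddId n
  simp_rw [sum_oddId] at h
  rw [← h, Finset.sum_filter]
  rw [Finset.range_eq_Ico, Finset.sum_eq_sum_Ico_succ_bot (Nat.succ_pos n)]
  simp only [Nat.not_odd_zero, if_false, zero_add]
  refine Finset.sum_congr (by ext; simp; omega) fun x hx => ?_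
  rw [oddMu_mul_oddId x (by simp at hx; omega)]

lemma psi_div_eq (n : ℕ) :
    (∑ i ∈ (Finset.range (n + 1)).filter (fun i => Odd i), Nat.totient i : ℝ) / (n : ℝ) ^ 2 =
      ∑' d : ℕ, oddMu d * ((((n / d + 1) / 2 : ℕ) : ℝ) / n) ^ 2 := by
  rw [psi_eq, Finset.sum_div, tsum_eq_sum (s := Finset.Ioc 0 n)]
  · refine Finset.sum_congr rfl fun d _ => ?_
    rw [div_pow, mul_div_assoc]
  · intro d hd
    simp only [Finset.mem_Ioc, not_and, not_le] at hd
    rcases Nat.eq_zero_or_pos d with rfl | h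
    · simp
    · rw [Nat.div_eq_of_lt (hd h)]; simp

lemma quot_le (n d : ℕ) : (((n / d + 1) / 2 : ℕ) : ℝ) / n ≤ 1 / d := by
  have h1 : (((n / d + 1) / 2 : ℕ) : ℝ) ≤ (n / d : ℕ) := by
    have h : ∀ m : ℕ, (m + 1) / 2 ≤ m := fun m => by omega
    exact_mod_cast h (n / d)
  have h2 : ((n / d : ℕ) : ℝ) ≤ n / d := Nat.cast_div_le
  rcases Nat.eq_zero_or_pos n with rfl | h
  · simp
  have hn : (0 : ℝ) < n := by exact_mod_cast h
  rw [div_le_iff₀ hn]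
  calc _ ≤ _ := h1.trans h2
    _ = _ := by ring

lemma quot_tendsto (d : ℕ) (hd : 0 < d) :
    Tendsto (fun n : ℕ => (((n / d + 1) / 2 : ℕ) : ℝ) / n) atTop (nhds (1 / (2 * d))) := by
  rw [tendsto_iff_dist_tendsto_zero]
  refine squeeze_zero' (Eventually.of_forall fun _ => dist_nonneg) ?_
    tendsto_one_div_atTop_nhds_zero_nat
  filter_upwards [eventually_gt_atTop 0] with n hn
  have hn' : (0 : ℝ) < n := by exact_mod_cast hn
  have hd' : (0 : ℝ) < d := by exact_mod_cast hd
  have hq : (n / d + 1) / 2 = (n + d) / (2 * d) := by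
    rw [← Nat.add_div_right n hd, Nat.div_div_eq_div_mul, mul_comm d 2]
  rw [hq]
  set q := (n + d) / (2 * d) with hqd
  have e1 : 2 * d * q ≤ n + d := Nat.mul_div_le _ _
  have e2 : n + d < 2 * d * (q + 1) := Nat.lt_mul_div_succ _ (by omega)
  have e1' : 2 * (d : ℝ) * q ≤ n + d := by exact_mod_cast e1
  have e2' : (n : ℝ) + d < 2 * d * (q + 1) := by exact_mod_cast e2
  have : (q : ℝ) / n - 1 / (2 * d) = (2 * d * q - n) / (2 * d) / n := by field_simp
  rw [Real.dist_eq, this, abs_div, abs_of_pos hn']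
  gcongr
  rw [abs_le]
  constructor
  · rw [le_div_iff₀ (by positivity)]; linarith
  · rw [div_le_iff₀ (by positivity)]; linarith

lemma tsum_oddMu : ∑' d : ℕ, oddMu d * (1 / (d : ℝ) ^ 2) = 8 / Real.pi ^ 2 := by
  have h2 : (1 : ℝ) < (2 : ℂ).re := by norm_num
  have h := DirichletCharacter.LSeries.mul_mu_eq_one (1 : DirichletCharacter ℂ 2) h2
  have hL : LSeries (fun n : ℕ => (1 : DirichletCharacter ℂ 2) n) 2 = (Real.pi : ℂ) ^ 2 / 8 := by
    rw [← DirichletCharacter.LFunction_eq_LSeries _ h2]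
    have := DirichletCharacter.LFunctionTrivChar_eq_mul_riemannZeta (N := 2) (s := 2) (by norm_num)
    rw [DirichletCharacter.LFunctionTrivChar] at this
    rw [this, riemannZeta_two, Nat.Prime.primeFactors Nat.prime_two]
    have : (2 : ℂ) ^ (-2 : ℂ) = 1 / 4 := by
      rw [Complex.cpow_neg, Complex.cpow_ofNat]; norm_num
    simp [this]
    ring
  have hM : LSeries ((fun n : ℕ => (1 : DirichletCharacter ℂ 2) n) *
      fun n : ℕ => (ArithmeticFunction.moebius n : ℂ)) 2 =
      ((∑' d : ℕ, oddMu d * (1 / (d : ℝ) ^ 2) : ℝ) : ℂ) := by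
    rw [LSeries, Complex.ofReal_tsum]
    refine tsum_congr fun d => ?_
    rcases Nat.eq_zero_or_pos d with rfl | hd
    · simp
    rw [LSeries.term_of_ne_zero hd.ne', oddMu_apply, Pi.mul_apply, Complex.cpow_ofNat]
    split_ifs with ho
    · rw [MulChar.one_apply ((ZMod.isUnit_iff_coprime d 2).2 (Nat.coprime_two_right.2 ho))]
      push_cast
      ring
    · rw [MulChar.map_nonunit _ (fun hu => ho (Nat.coprime_two_right.1
        ((ZMod.isUnit_iff_coprime d 2).1 hu)))]
      simp
  rw [hL, hM] at h
  have h' : Real.pi ^ 2 / 8 * (∑' d : ℕ, oddMu d * (1 / (d : ℝ) ^ 2)) = 1 := by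
    exact_mod_cast h
  have := Real.pi_pos
  field_simp at h' ⊢
  linarith

/-- Lemma 5.2: Ψ(n) = ∑_{i ≤ n, i odd} φ(i) ∼ 2n²/π² as n → ∞. -/
theorem stmt_6 :
    Tendsto (fun n : ℕ =>
      ((∑ i ∈ (Finset.range (n + 1)).filter (fun i => Odd i), Nat.totient i : ℝ) *
        Real.pi ^ 2) / (2 * (n : ℝ) ^ 2))
      atTop (nhds 1) := by
  have key : Tendsto (fun n : ℕ => ∑' d : ℕ, oddMu d * ((((n / d + 1) / 2 : ℕ) : ℝ) / n) ^ 2)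
      atTop (nhds (∑' d : ℕ, oddMu d * (1 / (2 * d) : ℝ) ^ 2)) := by
    refine tendsto_tsum_of_dominated_convergence (bound := fun d : ℕ => 1 / (d : ℝ) ^ 2)
      (Real.summable_one_div_nat_pow.2 one_lt_two) ?_ ?_
    · intro d
      rcases Nat.eq_zero_or_pos d with rfl | hd
      · simp
      · exact ((quot_tendsto d hd).pow 2).const_mul _
    · refine Eventually.of_forall fun n d => ?_
      rw [norm_mul, Real.norm_eq_abs, norm_pow, Real.norm_of_nonneg (by positivity)]
      calc _ ≤ 1 * (1 / (d : ℝ)) ^ 2 := by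
            exact mul_le_mul (abs_oddMu_le d) (pow_le_pow_left₀ (by positivity) (quot_le n d) 2)
              (by positivity) zero_le_one
        _ = _ := by rw [one_mul, div_pow, one_pow]
  have hv : ∑' d : ℕ, oddMu d * (1 / (2 * d) : ℝ) ^ 2 = 2 / Real.pi ^ 2 := by
    have : ∀ d : ℕ, oddMu d * (1 / (2 * d) : ℝ) ^ 2 = 1 / 4 * (oddMu d * (1 / (d : ℝ) ^ 2)) := by
      intro d
      rw [one_div, mul_inv]; ring
    simp_rw [this]
    rw [tsum_mul_left, tsum_oddMu]; ring
  rw [hv] at key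
  have := key.mul_const (Real.pi ^ 2 / 2)
  have hp := Real.pi_pos
  have e : 2 / Real.pi ^ 2 * (Real.pi ^ 2 / 2) = 1 := by field_simp
  rw [e] at this
  refine this.congr fun n => ?_
  rw [← psi_div_eq, div_mul_div_comm, mul_comm (2 : ℝ)]
end
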